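/- Let n ≥ 100 be an integer and let ε ∈ (0, 1/1000). Let S ∈ ℝ^{n×n} be invertible with least singular value σ_n(S) ≥ 9·√(ln(2n(1 + 1/ε))/π), write σ_1 = σ_1(S) for the largest singular value. Let m be an integer with m > 30·n·log₂(σ_1·n), and let X ∈ ℤ^{n×m} have its m columns drawn independently from the discrete Gaussian D_{ℤ^n, S}. Then with probability at least 1 − 2^{−n}, the matrix X has quality (σ_1·√(n·log₂ m), 2·√(30·n·log₂(σ_1·n))). -/

import Mathlib

open scoped BigOperators Matrix
attribute [local instance] Classical.propDecidable

/-- Ellipsoidal Gaussian function `ρ_S(x) = exp(-π xᵀ (SᵀS)⁻¹ x)` for a (rank-`n`)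
matrix `S ∈ ℝ^{m×n}` and `x ∈ ℝ^n`. -/
noncomputable def rho {m n : ℕ} (S : Matrix (Fin m) (Fin n) ℝ) (x : Fin n → ℝ) : ℝ :=
  Real.exp (-Real.pi * (x ⬝ᵥ ((Sᵀ * S)⁻¹ *ᵥ x)))

/-- Coordinatewise cast of an integer vector to a real vector. -/
def intCast' {k : ℕ} (v : Fin k → ℤ) : Fin k → ℝ := fun i => (v i : ℝ)

/-- Euclidean (ℓ2) norm of a real vector. -/
noncomputable def enorm' {k : ℕ} (x : Fin k → ℝ) : ℝ := Real.sqrt (∑ i, (x i) ^ 2)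

/-- `X ∈ ℤ^{n×m}` has quality `(q1, q2)`: every column has ℓ2-norm at most `q1`, and
there are pairwise orthogonal `u_1, …, u_n ∈ ℤ^m` with `u_i ⬝ x_j = δ_{ij}` (where
`x_j` are the rows of `X`) and `‖u_i‖₂ ≤ q2`. -/
def HasQuality {n m : ℕ} (X : Matrix (Fin n) (Fin m) ℤ) (q1 q2 : ℝ) : Prop :=
  (∀ j : Fin m, Real.sqrt (∑ i, ((X i j : ℝ)) ^ 2) ≤ q1) ∧
  ∃ u : Fin n → Fin m → ℤ,
    (∀ i i', i ≠ i' → ∑ j, u i j * u i' j = 0) ∧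
    (∀ i i', ∑ j, u i j * X i' j = if i = i' then 1 else 0) ∧
    (∀ i, Real.sqrt (∑ j, ((u i j : ℝ)) ^ 2) ≤ q2)


open scoped ENNReal

section ProductExpectation

variable {α : Type*}

/-- Expectation of `g` over `t` independent draws from the weights `w`. -/
noncomputable def expect (w : α → ℝ≥0∞) {t : ℕ} (g : (Fin t → α) → ℝ≥0∞) : ℝ≥0∞ :=
  ∑' X : Fin t → α, (∏ s, w (X s)) * g X

theorem expect_zero (w : α → ℝ≥0∞) (g : (Fin 0 → α) → ℝ≥0∞) : expect w g = g Fin.elim0 := by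
  unfold expect
  rw [tsum_eq_single Fin.elim0]
  · simp
  · intro X hX
    exact absurd (Subsingleton.elim _ _) hX

theorem expect_succ (w : α → ℝ≥0∞) {t : ℕ} (g : (Fin (t + 1) → α) → ℝ≥0∞) :
    expect w g = expect w (fun X => ∑' v, w v * g (Fin.cons v X)) := by
  unfold expect
  rw [← (Fin.consEquiv (fun _ : Fin (t + 1) => α)).tsum_eq, ENNReal.tsum_prod', ENNReal.tsum_comm]
  refine tsum_congr fun X => ?_
  rw [← ENNReal.tsum_mul_left]
  refine tsum_congr fun v => ?_
  simp only [Fin.consEquiv, Equiv.coe_fn_mk, Fin.prod_univ_succ, Fin.cons_zero, Fin.cons_succ]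
  ring

theorem expect_mono {w : α → ℝ≥0∞} {t : ℕ} {g h : (Fin t → α) → ℝ≥0∞} (hgh : ∀ X, g X ≤ h X) :
    expect w g ≤ expect w h :=
  ENNReal.tsum_le_tsum fun X => mul_le_mul_right (hgh X) _

theorem expect_add (w : α → ℝ≥0∞) {t : ℕ} (g h : (Fin t → α) → ℝ≥0∞) :
    expect w (fun X => g X + h X) = expect w g + expect w h := by
  simp only [expect, mul_add, ENNReal.tsum_add]

theorem expect_const_mul (w : α → ℝ≥0∞) {t : ℕ} (c : ℝ≥0∞) (g : (Fin t → α) → ℝ≥0∞) :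
    expect w (fun X => c * g X) = c * expect w g := by
  simp only [expect, ← ENNReal.tsum_mul_left]
  exact tsum_congr fun X => by ring

theorem expect_one (w : α → ℝ≥0∞) (t : ℕ) :
    expect w (fun _ : Fin t → α => 1) = (∑' v, w v) ^ t := by
  induction t with
  | zero => simp [expect_zero]
  | succ t ih =>
    have h := expect_const_mul w (t := t) (∑' v, w v) fun _ => 1
    simp only [mul_one] at h
    rw [expect_succ, pow_succ', ← ih, ← h]
    simp only [mul_one]

theorem expect_exists_le {w : α → ℝ≥0∞} (hw : ∑' v, w v = 1) (p : α → Prop) (t : ℕ) :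
    expect w (fun X : Fin t → α => if ∃ s, p (X s) then 1 else 0)
      ≤ t * ∑' v, w v * if p v then 1 else 0 := by
  induction t with
  | zero => simp [expect_zero]
  | succ t ih =>
    rw [expect_succ]
    calc _ ≤ expect w (fun X : Fin t → α => (∑' v, w v * if p v then 1 else 0) * 1
              + if ∃ s, p (X s) then 1 else 0) := by
          refine expect_mono fun X => ?_
          have h : (if ∃ s, p (X s) then (1 : ℝ≥0∞) else 0)
              = ∑' v, w v * if ∃ s, p (X s) then 1 else 0 := by
            rw [ENNReal.tsum_mul_right, hw, one_mul]
          rw [h, mul_one, ← ENNReal.tsum_add]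
          refine ENNReal.tsum_le_tsum fun v => ?_
          rw [← mul_add]
          gcongr
          simp only [Fin.exists_fin_succ, Fin.cons_zero, Fin.cons_succ]
          by_cases h1 : p v <;> by_cases h2 : ∃ s, p (X s) <;> simp [h1, h2]
      _ ≤ _ := by
          rw [expect_add, expect_const_mul, expect_one, hw, one_pow, mul_one]
          push_cast
          rw [add_mul, one_mul, add_comm]
          gcongr

/-- An event that is inherited when a sample is prepended can only lose probability. -/
theorem expect_antitone_of_cons {w : α → ℝ≥0∞} (hw : ∑' v, w v = 1)
    (p : ∀ t, (Fin t → α) → Prop)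
    (hp : ∀ t v (X : Fin t → α), p (t + 1) (Fin.cons v X) → p t X) {k m : ℕ} (hkm : k ≤ m) :
    expect w (fun X : Fin m → α => if p m X then 1 else 0)
      ≤ expect w (fun X : Fin k → α => if p k X then 1 else 0) := by
  induction m, hkm using Nat.le_induction with
  | base => exact le_rfl
  | succ m _ ih =>
    refine le_trans ?_ ih
    rw [expect_succ]
    refine expect_mono fun X => ?_
    have h : (if p m X then (1 : ℝ≥0∞) else 0) = ∑' v, w v * if p m X then 1 else 0 := by
      rw [ENNReal.tsum_mul_right, hw, one_mul]
    rw [h]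
    refine ENNReal.tsum_le_tsum fun v => ?_
    gcongr
    by_cases h1 : p (m + 1) (Fin.cons v X)
    · simp [h1, hp m v X h1]
    · simp [h1]

theorem expect_le_pow_of_contract {w : α → ℝ≥0∞} (Ψ : ∀ t, (Fin t → α) → ℝ≥0∞) (c : ℝ≥0∞)
    (h0 : ∀ X, Ψ 0 X ≤ 1)
    (h : ∀ t (X : Fin t → α), ∑' v, w v * Ψ (t + 1) (Fin.cons v X) ≤ c * Ψ t X) (t : ℕ) :
    expect w (Ψ t) ≤ c ^ t := by
  induction t with
  | zero => simpa [expect_zero] using h0 _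
  | succ t ih =>
    rw [expect_succ, pow_succ']
    calc _ ≤ expect w (fun X => c * Ψ t X) := expect_mono (h t)
      _ ≤ _ := by rw [expect_const_mul]; gcongr

end ProductExpectation

section SubsetSums

variable {M : Type*} [AddCommGroup M]

/-- The set of all sums of subfamilies of `c`. -/
noncomputable def subsetSums {t : ℕ} (c : Fin t → M) : Finset M :=
  Finset.univ.image fun z : Fin t → Bool => ∑ s, if z s then c s else 0

theorem mem_subsetSums {t : ℕ} {c : Fin t → M} {a : M} :
    a ∈ subsetSums c ↔ ∃ z : Fin t → Bool, ∑ s, (if z s then c s else 0) = a := by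
  simp [subsetSums]

theorem subsetSums_nonempty {t : ℕ} (c : Fin t → M) : (subsetSums c).Nonempty :=
  ⟨_, mem_subsetSums.2 ⟨fun _ => false, rfl⟩⟩

theorem card_subsetSums_le {t : ℕ} (c : Fin t → M) : (subsetSums c).card ≤ 2 ^ t :=
  Finset.card_image_le.trans (by simp)

theorem subsetSums_subset_cons {t : ℕ} (c₀ : M) (c : Fin t → M) :
    subsetSums c ⊆ subsetSums (Fin.cons c₀ c : Fin (t + 1) → M) := by
  intro a ha
  obtain ⟨z, rfl⟩ := mem_subsetSums.1 ha
  exact mem_subsetSums.2 ⟨Fin.cons false z, by simp [Fin.sum_univ_succ]⟩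

theorem two_mul_card_subsetSums_le {t : ℕ} {c₀ : M} {c : Fin t → M}
    (h : ∀ a ∈ subsetSums c, ∀ b ∈ subsetSums c, c₀ ≠ a - b) :
    2 * (subsetSums c).card ≤ (subsetSums (Fin.cons c₀ c : Fin (t + 1) → M)).card := by
  have hdis : Disjoint (subsetSums c) ((subsetSums c).image fun b => c₀ + b) := by
    rw [Finset.disjoint_left]
    intro a ha hb
    obtain ⟨b, hb, hab⟩ := Finset.mem_image.1 hb
    exact h a ha b hb (by rw [← hab]; abel)
  have hcard : ((subsetSums c).image fun b => c₀ + b).card = (subsetSums c).card :=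
    Finset.card_image_of_injective _ (add_right_injective c₀)
  rw [two_mul]
  nth_rewrite 2 [← hcard]
  rw [← Finset.card_union_of_disjoint hdis]
  refine Finset.card_le_card (Finset.union_subset (subsetSums_subset_cons c₀ c) ?_)
  intro a ha
  obtain ⟨b, hb, rfl⟩ := Finset.mem_image.1 ha
  obtain ⟨z, rfl⟩ := mem_subsetSums.1 hb
  exact mem_subsetSums.2 ⟨Fin.cons true z, by simp [Fin.sum_univ_succ]⟩

theorem card_subsetSums_map_le {M' : Type*} [AddCommGroup M'] (φ : M →+ M') {t : ℕ}
    (c : Fin t → M) : (subsetSums fun s => φ (c s)).card ≤ (subsetSums c).card := by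
  refine (Finset.card_le_card fun a ha => ?_).trans
    (Finset.card_image_le (s := subsetSums c) (f := φ))
  obtain ⟨z, rfl⟩ := mem_subsetSums.1 ha
  refine Finset.mem_image.2 ⟨_, mem_subsetSums.2 ⟨z, rfl⟩, ?_⟩
  rw [map_sum]
  exact Finset.sum_congr rfl fun s _ => by split_ifs <;> simp

theorem abs_subset_sum_le {t : ℕ} {B : ℤ} (hB : 0 ≤ B) {x : Fin t → ℤ} (hx : ∀ s, |x s| ≤ B)
    (z : Fin t → Bool) : |∑ s, if z s then x s else 0| ≤ t * B := by
  calc _ ≤ ∑ s : Fin t, |if z s then x s else 0| := Finset.abs_sum_le_sum_abs _ _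
    _ ≤ ∑ _s : Fin t, B := Finset.sum_le_sum fun s _ => by
        split_ifs
        · exact hx s
        · simpa using hB
    _ = _ := by simp

end SubsetSums

section GrowthProcess

variable {n : ℕ}

/-- `U` holds `i` pairwise orthogonal vectors with entries in `{-1, 0, 1}` that are dual to the
first `i` coordinates of the columns `X`; the remaining vectors are zero. -/
structure IsPartialDual {t : ℕ} (X U : Fin t → Fin n → ℤ) (i : ℕ) : Prop where
  abs_le : ∀ s j, |U s j| ≤ 1
  eq_zero : ∀ s (j : Fin n), i ≤ j → U s j = 0
  orthogonal : ∀ j j', j ≠ j' → ∑ s, U s j * U s j' = 0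
  dual : ∀ j a : Fin n, (j : ℕ) < i → ∑ s, U s j * X s a = if j = a then 1 else 0

/-- A full system of pairwise orthogonal dual vectors exists. -/
def HasDual {t : ℕ} (X : Fin t → Fin n → ℤ) : Prop := ∃ U, IsPartialDual X U n

theorem isPartialDual_zero {t : ℕ} (X : Fin t → Fin n → ℤ) : IsPartialDual X 0 0 where
  abs_le := by simp
  eq_zero := by simp
  orthogonal := by simp
  dual := by simp

theorem IsPartialDual.cons_zero {t : ℕ} {X U : Fin t → Fin n → ℤ} {i : ℕ}
    (h : IsPartialDual X U i) (v : Fin n → ℤ) :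
    IsPartialDual (Fin.cons v X : Fin (t + 1) → Fin n → ℤ) (Fin.cons 0 U) i where
  abs_le s j := by
    refine Fin.cases ?_ (fun s => ?_) s
    · simp
    · simpa using h.abs_le s j
  eq_zero s j hj := by
    refine Fin.cases ?_ (fun s => ?_) s
    · simp
    · simpa using h.eq_zero s j hj
  orthogonal j j' hj := by simpa [Fin.sum_univ_succ] using h.orthogonal j j' hj
  dual j a hj := by simpa [Fin.sum_univ_succ] using h.dual j a hj

theorem HasDual.cons {t : ℕ} {X : Fin t → Fin n → ℤ} (h : HasDual X) (v : Fin n → ℤ) :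
    HasDual (Fin.cons v X : Fin (t + 1) → Fin n → ℤ) :=
  let ⟨_, hU⟩ := h
  ⟨_, hU.cons_zero v⟩

theorem cons_pair {t : ℕ} (v v' : Fin n → ℤ) (X U : Fin t → Fin n → ℤ) :
    (fun s => ((Fin.cons v X : Fin (t + 1) → Fin n → ℤ) s,
      (Fin.cons v' U : Fin (t + 1) → Fin n → ℤ) s))
      = Fin.cons (v, v') fun s => (X s, U s) := by
  funext s
  refine Fin.cases ?_ (fun s => ?_) s <;> simp

theorem IsPartialDual.cons_single {t : ℕ} {X U : Fin t → Fin n → ℤ} {i : Fin n}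
    (h : IsPartialDual X U i) (v : Fin n → ℤ) (y : Fin t → ℤ) (hy : ∀ s, |y s| ≤ 1)
    (hX : ∀ a, v a + ∑ s, y s * X s a = if i = a then 1 else 0)
    (hU : ∀ j, ∑ s, y s * U s j = 0) :
    IsPartialDual (Fin.cons v X : Fin (t + 1) → Fin n → ℤ)
      (Fin.cons (Pi.single i 1) fun s => U s + Pi.single i (y s)) (i + 1) where
  abs_le s j := by
    refine Fin.cases ?_ (fun s => ?_) s
    · by_cases hj : j = i
      · subst hj; simp
      · simp [hj]
    · by_cases hj : j = i
      · subst hj; simpa [h.eq_zero s j le_rfl] using hy s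
      · simpa [hj] using h.abs_le s j
  eq_zero s j hj := by
    have hji : j ≠ i := by rintro rfl; omega
    refine Fin.cases ?_ (fun s => ?_) s
    · simp [hji]
    · simpa [hji] using h.eq_zero s j (by omega)
  orthogonal j j' hj := by
    by_cases h1 : j = i
    · subst h1
      have h2 : ∑ s, y s * U s j' = 0 := hU j'
      simpa [Fin.sum_univ_succ, hj.symm, h.eq_zero _ j le_rfl] using h2
    · by_cases h3 : j' = i
      · subst h3
        have h2 : ∑ s, U s j * y s = 0 := by simpa only [mul_comm] using hU j
        simpa [Fin.sum_univ_succ, hj, h.eq_zero _ j' le_rfl] using h2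
      · simpa [Fin.sum_univ_succ, h1, h3] using h.orthogonal j j' hj
  dual j a hj := by
    by_cases h1 : j = i
    · subst h1
      simpa [Fin.sum_univ_succ, h.eq_zero _ j le_rfl] using hX a
    · have h2 : (j : ℕ) ≠ i := fun e => h1 (Fin.ext e)
      simpa [Fin.sum_univ_succ, h1] using h.dual j a (by omega)

/-- The possible values of `2 ^ i` times the number of subset sums of the columns extended by a
partial dual system of size `i`. -/
def growthSet {t : ℕ} (X : Fin t → Fin n → ℤ) : Set ℕ :=
  {N | ∃ (i : ℕ) (U : Fin t → Fin n → ℤ), i ≤ n ∧ IsPartialDual X U i ∧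
    N = 2 ^ i * (subsetSums fun s => (X s, U s)).card}

/-- The largest element of `growthSet X`. -/
noncomputable def growth {t : ℕ} (X : Fin t → Fin n → ℤ) : ℕ := sSup (growthSet X)

theorem growthSet_bddAbove {t : ℕ} (X : Fin t → Fin n → ℤ) : BddAbove (growthSet X) := by
  refine ⟨2 ^ n * 2 ^ t, ?_⟩
  rintro _ ⟨i, U, hi, -, rfl⟩
  exact Nat.mul_le_mul (Nat.pow_le_pow_right two_pos hi) (card_subsetSums_le _)

theorem growth_mem {t : ℕ} (X : Fin t → Fin n → ℤ) : growth X ∈ growthSet X :=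
  Nat.sSup_mem ⟨_, 0, 0, Nat.zero_le _, isPartialDual_zero X, rfl⟩ (growthSet_bddAbove X)

theorem le_growth {t : ℕ} {X : Fin t → Fin n → ℤ} {N : ℕ} (h : N ∈ growthSet X) : N ≤ growth X :=
  le_csSup (growthSet_bddAbove X) h

theorem growth_pos {t : ℕ} (X : Fin t → Fin n → ℤ) : 0 < growth X := by
  obtain ⟨i, U, -, -, h⟩ := growth_mem X
  rw [h]
  exact Nat.mul_pos (Nat.pow_pos two_pos) (subsetSums_nonempty _).card_pos

theorem growth_le_cons {t : ℕ} (X : Fin t → Fin n → ℤ) (v : Fin n → ℤ) :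
    growth X ≤ growth (Fin.cons v X : Fin (t + 1) → Fin n → ℤ) := by
  obtain ⟨i, U, hi, hU, h⟩ := growth_mem X
  rw [h]
  refine le_trans ?_ (le_growth ⟨i, _, hi, hU.cons_zero v, rfl⟩)
  rw [cons_pair]
  exact Nat.mul_le_mul_left _ (Finset.card_le_card (subsetSums_subset_cons _ _))

/-- Unless a full dual system exists, there is a symmetric set `G` such that a new column doubles
the growth as soon as it lies outside `G`, or in a shift of `G` by a unit vector. -/
theorem exists_symmetric_growth_doubles {t : ℕ} {X : Fin t → Fin n → ℤ} (hX : ¬ HasDual X) :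
    ∃ (i : Fin n) (G : Set (Fin n → ℤ)), (∀ g ∈ G, -g ∈ G) ∧
      ∀ v, (v ∉ G ∨ v - Pi.single i 1 ∈ G) →
        2 * growth X ≤ growth (Fin.cons v X : Fin (t + 1) → Fin n → ℤ) := by
  obtain ⟨i, U, hi, hU, hN⟩ := growth_mem X
  have hi' : i < n := lt_of_le_of_ne hi (by rintro rfl; exact hX ⟨U, hU⟩)
  lift i to Fin n using hi'
  set A := subsetSums fun s => (X s, U s) with hA
  refine ⟨i, {g | ∃ a ∈ A, ∃ b ∈ A, (g, (0 : Fin n → ℤ)) = a - b}, ?_, ?_⟩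
  · rintro g ⟨a, ha, b, hb, h⟩
    refine ⟨b, hb, a, ha, ?_⟩
    rw [← neg_sub, ← h]
    simp
  · rintro v (hv | ⟨a, ha, b, hb, hab⟩)
    · refine le_trans ?_ (le_growth ⟨i, _, hi, hU.cons_zero v, rfl⟩)
      rw [hN, cons_pair, mul_left_comm]
      refine Nat.mul_le_mul_left _ (two_mul_card_subsetSums_le ?_)
      intro a ha b hb h
      exact hv ⟨a, ha, b, hb, h⟩
    · obtain ⟨z, rfl⟩ := mem_subsetSums.1 ha
      obtain ⟨z', rfl⟩ := mem_subsetSums.1 hb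
      set y : Fin t → ℤ := fun s => (if z' s then 1 else 0) - (if z s then 1 else 0) with hy
      have hpair : ∀ s, (if z s then (X s, U s) else 0) - (if z' s then (X s, U s) else 0)
          = (-(y s • X s), -(y s • U s)) := by
        intro s
        simp only [hy]
        split_ifs <;> simp [Prod.ext_iff]
      rw [← Finset.sum_sub_distrib, Finset.sum_congr rfl fun s _ => hpair s, Prod.ext_iff,
        Prod.fst_sum, Prod.snd_sum] at hab
      obtain ⟨h1, h2⟩ := hab
      simp only [Finset.sum_neg_distrib] at h1 h2
      have hyX : ∀ a, v a + ∑ s, y s * X s a = if i = a then 1 else 0 := by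
        intro a
        have := congrFun h1 a
        simp only [Pi.sub_apply, Pi.neg_apply, Finset.sum_apply, Pi.smul_apply, smul_eq_mul,
          Pi.single_apply] at this
        simp only [eq_comm (a := i)]
        linarith
      have hyU : ∀ j, ∑ s, y s * U s j = 0 := by
        intro j
        have := congrFun h2 j
        simp only [Pi.zero_apply, Pi.neg_apply, Finset.sum_apply, Pi.smul_apply,
          smul_eq_mul] at this
        linarith
      have hy1 : ∀ s, |y s| ≤ 1 := by
        intro s
        simp only [hy]
        split_ifs <;> simp
      refine le_trans ?_ (le_growth ⟨i + 1, _, i.2, hU.cons_single v y hy1 hyX hyU, rfl⟩)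
      rw [hN, cons_pair, pow_succ', ← mul_assoc]
      refine Nat.mul_le_mul_left _ ?_
      refine le_trans ?_ (Finset.card_le_card (subsetSums_subset_cons _ _))
      let φ : (Fin n → ℤ) × (Fin n → ℤ) →+ (Fin n → ℤ) × (Fin n → ℤ) :=
        { toFun := fun p => (p.1, Function.update p.2 i 0)
          map_zero' := by simp
          map_add' := fun p q => by
            refine Prod.ext rfl ?_
            funext j
            by_cases hj : j = i
            · subst hj; simp
            · simp [hj] }
      have hφ : (fun s => (X s, U s)) = fun s => φ (X s, U s + Pi.single i (y s)) := by
        funext s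
        refine Prod.ext rfl ?_
        funext j
        by_cases hj : j = i
        · subst hj; simp [φ, hU.eq_zero s j le_rfl]
        · simp [φ, hj]
      rw [hA, hφ]
      exact card_subsetSums_map_le φ _

theorem growth_le_of_forall_abs_le {t : ℕ} {X : Fin t → Fin n → ℤ} {B : ℕ}
    (hB : ∀ s a, |X s a| ≤ B) :
    growth X ≤ 2 ^ n * ((2 * (t * B) + 1) ^ n * (2 * t + 1) ^ n) := by
  obtain ⟨i, U, hi, hU, h⟩ := growth_mem X
  rw [h]
  refine Nat.mul_le_mul (Nat.pow_le_pow_right two_pos hi) ?_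
  let E : Finset ((Fin n → ℤ) × (Fin n → ℤ)) :=
    (Fintype.piFinset fun _ => Finset.Icc (-(t * B : ℤ)) (t * B)) ×ˢ
      Fintype.piFinset fun _ => Finset.Icc (-(t : ℤ)) t
  have hE : E.card = (2 * (t * B) + 1) ^ n * (2 * t + 1) ^ n := by
    simp only [E, Finset.card_product, Fintype.card_piFinset, Int.card_Icc, Finset.prod_const,
      Finset.card_univ, Fintype.card_fin]
    congr 2
    · rw [← Nat.cast_mul]
      omega
    · omega
  rw [← hE]
  refine Finset.card_le_card fun a ha => ?_
  obtain ⟨z, rfl⟩ := mem_subsetSums.1 ha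
  have h0 : ∀ s, (if z s then (X s, U s) else 0)
      = ((if z s then X s else 0), (if z s then U s else 0)) := by
    intro s; split_ifs <;> rfl
  simp only [E, Finset.mem_product, Fintype.mem_piFinset, Finset.mem_Icc, ← abs_le, h0,
    Prod.fst_sum, Prod.snd_sum, Finset.sum_apply]
  refine ⟨fun j => ?_, fun j => ?_⟩
  · have := abs_subset_sum_le (Int.natCast_nonneg B) (fun s => hB s j) z
    simpa only [apply_ite (fun f : Fin n → ℤ => f j), Pi.zero_apply] using this
  · have := abs_subset_sum_le zero_le_one (fun s => hU.abs_le s j) z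
    simpa only [apply_ite (fun f : Fin n → ℤ => f j), Pi.zero_apply, mul_one] using this

/-- The potential controlling the search for a dual system. -/
noncomputable def potential {t : ℕ} (X : Fin t → Fin n → ℤ) : ℝ≥0∞ :=
  if HasDual X then 0 else (growth X : ℝ≥0∞)⁻¹

/-- The shift condition on the weights that makes the potential contract. -/
theorem tsum_potential_cons_le {w : (Fin n → ℤ) → ℝ≥0∞} (hw : ∑' v, w v = 1)
    (hshift : ∀ (i : Fin n) (G : Set (Fin n → ℤ)), (∀ g ∈ G, -g ∈ G) →
      4 / 5 * ∑' v, w v * (if v ∈ G then 1 else 0)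
        ≤ ∑' v, w v * (if v - Pi.single i 1 ∈ G then 1 else 0))
    {t : ℕ} (X : Fin t → Fin n → ℤ) :
    ∑' v, w v * potential (Fin.cons v X : Fin (t + 1) → Fin n → ℤ) ≤ 4 / 5 * potential X := by
  by_cases hX : HasDual X
  · simp [potential, hX, hX.cons]
  obtain ⟨i, G, hG, hdouble⟩ := exists_symmetric_growth_doubles hX
  have hcompl : ∀ p : (Fin n → ℤ) → Prop,
      (∑' v, w v * (if p v then 1 else 0)) + ∑' v, w v * (if p v then 0 else 1) = 1 := by
    intro p
    rw [← ENNReal.tsum_add]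
    nth_rewrite 3 [← hw]
    refine tsum_congr fun v => ?_
    split_ifs <;> simp
  have key : ∃ p : (Fin n → ℤ) → Prop, 2 / 5 ≤ ∑' v, w v * (if p v then 1 else 0) ∧
      ∀ v, p v → 2 * growth X ≤ growth (Fin.cons v X : Fin (t + 1) → Fin n → ℤ) := by
    by_cases hhalf : 1 / 2 ≤ ∑' v, w v * (if v ∈ G then 1 else 0)
    · refine ⟨fun v => v - Pi.single i 1 ∈ G, le_trans ?_ (hshift i G hG),
        fun v hv => hdouble v (Or.inr hv)⟩
      refine le_trans ?_ (mul_le_mul_right hhalf _)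
      rw [← ENNReal.toReal_le_toReal (by finiteness) (by finiteness)]
      norm_num [ENNReal.toReal_div, ENNReal.toReal_mul]
    · refine ⟨fun v => v ∉ G, ?_, fun v hv => hdouble v (Or.inl hv)⟩
      have h1 := hcompl fun v => v ∈ G
      rw [not_le] at hhalf
      by_contra hlt
      rw [not_le] at hlt
      have h3 : (1 / 2 + 2 / 5 : ℝ≥0∞) ≤ 1 := by
        rw [← ENNReal.toReal_le_toReal (by finiteness) (by finiteness),
          ENNReal.toReal_add (by finiteness) (by finiteness)]
        norm_num [ENNReal.toReal_div]
      refine absurd (ENNReal.add_lt_add hhalf hlt) (not_lt.2 (h3.trans ?_))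
      refine h1.ge.trans (add_le_add le_rfl (ENNReal.tsum_le_tsum fun v => ?_))
      by_cases hv : v ∈ G <;> simp [hv]
  obtain ⟨p, hp, hdouble'⟩ := key
  have hN0 : (growth X : ℝ≥0∞) ≠ 0 := by exact_mod_cast (growth_pos X).ne'
  calc _ ≤ ∑' v, (growth X : ℝ≥0∞)⁻¹ *
        (2⁻¹ * (w v * if p v then 1 else 0) + w v * if p v then 0 else 1) := by
        refine ENNReal.tsum_le_tsum fun v => ?_
        have hle : potential (Fin.cons v X : Fin (t + 1) → Fin n → ℤ)
            ≤ (growth (Fin.cons v X : Fin (t + 1) → Fin n → ℤ) : ℝ≥0∞)⁻¹ := by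
          unfold potential
          split_ifs
          · exact zero_le
          · exact le_rfl
        by_cases hpv : p v
        · have h2 : ((2 : ℝ≥0∞) * growth X)
              ≤ growth (Fin.cons v X : Fin (t + 1) → Fin n → ℤ) := by
            exact_mod_cast hdouble' v hpv
          have h3 := hle.trans (ENNReal.inv_le_inv.2 h2)
          rw [ENNReal.mul_inv (by simp) (by simp)] at h3
          simp only [hpv, if_true, mul_zero, add_zero, mul_one]
          calc _ ≤ w v * (2⁻¹ * (growth X : ℝ≥0∞)⁻¹) := by gcongr
            _ = _ := by ring
        · have h2 : (growth X : ℝ≥0∞)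
              ≤ growth (Fin.cons v X : Fin (t + 1) → Fin n → ℤ) := by
            exact_mod_cast growth_le_cons X v
          have h3 := hle.trans (ENNReal.inv_le_inv.2 h2)
          simp only [hpv, if_false, mul_zero, zero_add, mul_one]
          rw [mul_comm]
          gcongr
    _ ≤ _ := by
        rw [ENNReal.tsum_mul_left, ENNReal.tsum_add, ENNReal.tsum_mul_left, potential,
          if_neg hX, mul_comm (4 / 5 : ℝ≥0∞)]
        gcongr
        have h1 := hcompl p
        set a := ∑' v, w v * (if p v then 1 else 0)
        set b := ∑' v, w v * (if p v then 0 else 1)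
        have ha : a ≠ ⊤ := fun h => by simp [h] at h1
        have hb : b ≠ ⊤ := fun h => by simp [h] at h1
        rw [← ENNReal.toReal_le_toReal (by finiteness) (by finiteness)] at hp ⊢
        have h1' := congrArg ENNReal.toReal h1
        rw [ENNReal.toReal_add (by finiteness) (by finiteness)] at h1' ⊢
        norm_num [ENNReal.toReal_div, ENNReal.toReal_mul] at h1' hp ⊢
        linarith

theorem expect_potential_le {w : (Fin n → ℤ) → ℝ≥0∞} (hw : ∑' v, w v = 1)
    (hshift : ∀ (i : Fin n) (G : Set (Fin n → ℤ)), (∀ g ∈ G, -g ∈ G) →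
      4 / 5 * ∑' v, w v * (if v ∈ G then 1 else 0)
        ≤ ∑' v, w v * (if v - Pi.single i 1 ∈ G then 1 else 0)) (t : ℕ) :
    expect w (fun X : Fin t → Fin n → ℤ => potential X) ≤ (4 / 5) ^ t := by
  refine expect_le_pow_of_contract (fun t X => potential X) (4 / 5) (fun X => ?_)
    (fun t X => tsum_potential_cons_le hw hshift X) t
  unfold potential
  split_ifs
  · exact zero_le
  · refine ENNReal.inv_le_one.2 ?_
    exact_mod_cast growth_pos X

/-- Failure probability of the search for a dual system among `t` columns. -/
theorem expect_not_hasDual_le {w : (Fin n → ℤ) → ℝ≥0∞} (hw : ∑' v, w v = 1)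
    (hshift : ∀ (i : Fin n) (G : Set (Fin n → ℤ)), (∀ g ∈ G, -g ∈ G) →
      4 / 5 * ∑' v, w v * (if v ∈ G then 1 else 0)
        ≤ ∑' v, w v * (if v - Pi.single i 1 ∈ G then 1 else 0)) (t B : ℕ) :
    expect w (fun X : Fin t → Fin n → ℤ => if ¬ HasDual X then 1 else 0)
      ≤ t * (∑' v, w v * if ∃ a, (B : ℤ) < |v a| then 1 else 0)
        + (2 ^ n * ((2 * (t * B) + 1) ^ n * (2 * t + 1) ^ n)) * (4 / 5) ^ t := by
  have hlarge := expect_exists_le hw (fun v => ∃ a, (B : ℤ) < |v a|) t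
  refine le_trans ?_ (add_le_add (le_trans hlarge (by simp))
    (mul_le_mul_right (expect_potential_le hw hshift t) _))
  rw [← expect_const_mul, ← expect_add]
  refine expect_mono fun X => ?_
  by_cases hX : HasDual X
  · simp [hX]
  by_cases hlarge : ∃ s a, (B : ℤ) < |X s a|
  · simp [hX, hlarge]
  · simp only [hX, hlarge, not_false_eq_true, if_true, if_false, zero_add, potential]
    push Not at hlarge
    have h := growth_le_of_forall_abs_le hlarge
    have hN0 : (growth X : ℝ≥0∞) ≠ 0 := by exact_mod_cast (growth_pos X).ne'
    calc (1 : ℝ≥0∞) = growth X * (growth X : ℝ≥0∞)⁻¹ := (ENNReal.mul_inv_cancel hN0 (by simp)).symm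
      _ ≤ _ := by
        gcongr
        exact_mod_cast h

end GrowthProcess

section QuadraticGaussian

open Real

/-- The weight `exp (-π q x)` as an extended nonnegative real. -/
noncomputable def gaussianWeight {V : Type*} (q : V → ℝ) (x : V) : ℝ≥0∞ :=
  ENNReal.ofReal (exp (-π * q x))

variable {V : Type*} [AddCommGroup V] {q : V → ℝ}

theorem map_neg_of_parallelogram (hq : ∀ x y, q (x + y) + q (x - y) = 2 * q x + 2 * q y) (x : V) :
    q (-x) = q x := by
  have h0 := hq 0 0
  have h1 := hq 0 x
  simp only [add_zero, sub_zero, zero_add, zero_sub] at h0 h1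
  linarith

theorem two_mul_exp_half_le (a b : ℝ) : 2 * exp ((a + b) / 2) ≤ exp a + exp b := by
  have h := two_mul_le_add_sq (exp (a / 2)) (exp (b / 2))
  have hsq : ∀ c : ℝ, exp (c / 2) ^ 2 = exp c := fun c => by
    rw [← exp_nat_mul]
    congr 1
    push_cast
    ring
  rwa [mul_assoc, ← exp_add, hsq, hsq, ← add_div] at h

/-- Shifting a symmetric set by `e` costs at most a factor `exp (-π q e)` in Gaussian mass. -/
theorem gaussianWeight_mul_tsum_le
    (hq : ∀ x y, q (x + y) + q (x - y) = 2 * q x + 2 * q y) (e : V) (G : Set V)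
    (hG : ∀ g ∈ G, -g ∈ G) :
    gaussianWeight q e * ∑' v, gaussianWeight q v * (if v ∈ G then 1 else 0)
      ≤ ∑' v, gaussianWeight q v * (if v - e ∈ G then 1 else 0) := by
  have h1 : ∑' v, gaussianWeight q v * (if v - e ∈ G then 1 else 0)
      = ∑' v, gaussianWeight q (v + e) * (if v ∈ G then 1 else 0) := by
    rw [← (Equiv.addRight e).tsum_eq]
    simp
  have h2 : ∑' v, gaussianWeight q v * (if v - e ∈ G then 1 else 0)
      = ∑' v, gaussianWeight q (v - e) * (if v ∈ G then 1 else 0) := by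
    rw [h1, ← (Equiv.neg V).tsum_eq]
    refine tsum_congr fun v => ?_
    have hv : -v ∈ G ↔ v ∈ G := ⟨fun h => by simpa using hG _ h, hG v⟩
    have hqv : q (-v + e) = q (v - e) := by rw [← map_neg_of_parallelogram hq, neg_add', neg_neg]
    simp [gaussianWeight, hqv, hv]
  have h3 : 2 * (gaussianWeight q e * ∑' v, gaussianWeight q v * (if v ∈ G then 1 else 0))
      ≤ 2 * ∑' v, gaussianWeight q v * (if v - e ∈ G then 1 else 0) := by
    rw [two_mul (tsum _)]
    nth_rewrite 1 [h1]
    rw [h2, ← ENNReal.tsum_add, ← ENNReal.tsum_mul_left, ← ENNReal.tsum_mul_left]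
    refine ENNReal.tsum_le_tsum fun v => ?_
    rw [← mul_assoc, ← mul_assoc, ← add_mul]
    gcongr
    unfold gaussianWeight
    rw [← ENNReal.ofReal_add (exp_nonneg _) (exp_nonneg _), mul_assoc,
      ← ENNReal.ofReal_mul (exp_nonneg _), ← exp_add, ← ENNReal.ofReal_ofNat 2,
      ← ENNReal.ofReal_mul zero_le_two]
    refine ENNReal.ofReal_le_ofReal (le_trans (le_of_eq ?_) (two_mul_exp_half_le _ _))
    have := hq v e
    congr 2
    linear_combination (π / 2) * this
  exact (ENNReal.mul_le_mul_iff_right (by simp) (by simp)).1 h3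

theorem tsum_gaussianWeight_quarter_le {n : ℕ} {q : (Fin n → ℤ) → ℝ}
    (hq : ∀ x y, q (x + y) + q (x - y) = 2 * q x + 2 * q y) {Q : ℝ}
    (hQ : ∀ d : Fin n → Bool, q (fun i => if d i then 1 else 0) ≤ Q) :
    ∑' v, gaussianWeight (fun x => q x / 4) v
      ≤ 2 ^ n * ENNReal.ofReal (exp (π * Q / 4)) * ∑' v, gaussianWeight q v := by
  let δ : (Fin n → Bool) → Fin n → ℤ := fun d i => if d i then 1 else 0
  have hsurj : Function.Surjective
      fun p : (Fin n → Bool) × (Fin n → ℤ) => p.2 + (p.2 + δ p.1) := by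
    intro x
    refine ⟨(fun i => decide (x i % 2 = 1), fun i => x i / 2), ?_⟩
    funext i
    simp only [Pi.add_apply, δ, decide_eq_true_eq]
    split_ifs <;> omega
  refine (ENNReal.tsum_le_tsum_comp_of_surjective hsurj _).trans ?_
  rw [ENNReal.tsum_prod']
  have hinner : ∀ d : Fin n → Bool,
      ∑' h, gaussianWeight (fun x => q x / 4) (h + (h + δ d))
        ≤ ENNReal.ofReal (exp (π * Q / 4)) * ∑' v, gaussianWeight q v := by
    intro d
    have hsum : ∑' h, ENNReal.ofReal (exp (π * Q / 4)) *
          (2⁻¹ * (gaussianWeight q h + gaussianWeight q (h + δ d)))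
        = ENNReal.ofReal (exp (π * Q / 4)) * ∑' v, gaussianWeight q v := by
      have hshift := (Equiv.addRight (δ d)).tsum_eq (gaussianWeight q)
      simp only [Equiv.coe_addRight] at hshift
      rw [ENNReal.tsum_mul_left, ENNReal.tsum_mul_left, ENNReal.tsum_add, hshift, ← two_mul,
        ← mul_assoc 2⁻¹, ENNReal.inv_mul_cancel (by simp) (by simp), one_mul]
    rw [← hsum]
    refine ENNReal.tsum_le_tsum fun h => ?_
    have h2 : (2⁻¹ : ℝ≥0∞) = ENNReal.ofReal 2⁻¹ := by
      rw [ENNReal.ofReal_inv_of_pos zero_lt_two, ENNReal.ofReal_ofNat]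
    unfold gaussianWeight
    rw [h2, ← ENNReal.ofReal_add (exp_nonneg _) (exp_nonneg _),
      ← ENNReal.ofReal_mul (by norm_num), ← ENNReal.ofReal_mul (exp_nonneg _)]
    refine ENNReal.ofReal_le_ofReal ?_
    have hpar := hq (h + δ d) h
    rw [add_sub_cancel_left, add_comm (h + δ d) h] at hpar
    have hd : q (δ d) ≤ Q := hQ d
    calc exp (-π * (q (h + (h + δ d)) / 4))
        ≤ exp (π * Q / 4 + (-π * q h + -π * q (h + δ d)) / 2) := by
          refine exp_le_exp.2 ?_
          have := mul_le_mul_of_nonneg_left hd pi_pos.le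
          linear_combination (π / 4) * hpar.ge + this / 4
      _ = exp (π * Q / 4) * exp ((-π * q h + -π * q (h + δ d)) / 2) := exp_add _ _
      _ ≤ _ := by
          gcongr
          linarith [two_mul_exp_half_le (-π * q h) (-π * q (h + δ d))]
  refine (ENNReal.tsum_le_tsum hinner).trans (le_of_eq ?_)
  rw [tsum_fintype, Finset.sum_const, Finset.card_univ]
  simp [mul_assoc]

/-- Gaussian tail bound in terms of the quadratic form. -/
theorem tsum_gaussianWeight_tail_le {n : ℕ} {q : (Fin n → ℤ) → ℝ}
    (hq : ∀ x y, q (x + y) + q (x - y) = 2 * q x + 2 * q y) {Q : ℝ}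
    (hQ : ∀ d : Fin n → Bool, q (fun i => if d i then 1 else 0) ≤ Q) (T : ℝ) :
    ∑' v, gaussianWeight q v * (if T < q v then 1 else 0)
      ≤ ENNReal.ofReal (2 ^ n * exp (π * Q / 4) * exp (-(3 * π / 4 * T)))
        * ∑' v, gaussianWeight q v := by
  have h : ∑' v, gaussianWeight q v * (if T < q v then 1 else 0)
      ≤ ENNReal.ofReal (exp (-(3 * π / 4 * T))) * ∑' v, gaussianWeight (fun x => q x / 4) v := by
    rw [← ENNReal.tsum_mul_left]
    refine ENNReal.tsum_le_tsum fun v => ?_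
    split_ifs with hv
    · unfold gaussianWeight
      rw [mul_one, ← ENNReal.ofReal_mul (exp_nonneg _), ← exp_add]
      refine ENNReal.ofReal_le_ofReal (exp_le_exp.2 ?_)
      linear_combination (3 * π / 4) * hv.le
    · simp
  refine h.trans ((mul_le_mul_right (tsum_gaussianWeight_quarter_le hq hQ) _).trans (le_of_eq ?_))
  rw [ENNReal.ofReal_mul (by positivity), ENNReal.ofReal_mul (by positivity),
    ENNReal.ofReal_pow zero_le_two, ENNReal.ofReal_ofNat]
  ring

theorem summable_exp_neg_mul_int_sq {c : ℝ} (hc : 0 < c) :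
    Summable fun z : ℤ => exp (-c * (z : ℝ) ^ 2) := by
  have h : Summable fun k : ℕ => exp (-c * (k : ℝ) ^ 2) := by
    refine Summable.of_nonneg_of_le (fun _ => exp_nonneg _) (fun k => ?_)
      (summable_geometric_of_lt_one (exp_nonneg (-c)) (exp_lt_one_iff.2 (by linarith)))
    rw [← exp_nat_mul]
    refine exp_le_exp.2 ?_
    have hk : (k : ℝ) ≤ (k : ℝ) ^ 2 := by exact_mod_cast Nat.le_self_pow two_ne_zero k
    nlinarith
  refine Summable.of_nat_of_neg ?_ ?_ <;> simpa using h

theorem tsum_gaussianWeight_ne_top {n : ℕ} {q : (Fin n → ℤ) → ℝ} {c : ℝ} (hc : 0 < c)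
    (hq : ∀ v, c * ∑ i, (v i : ℝ) ^ 2 ≤ q v) : ∑' v, gaussianWeight q v ≠ ⊤ := by
  have h := expect_one (fun z : ℤ => ENNReal.ofReal (exp (-(π * c) * (z : ℝ) ^ 2))) n
  have hfin : ∑' z : ℤ, ENNReal.ofReal (exp (-(π * c) * (z : ℝ) ^ 2)) ≠ ⊤ :=
    (summable_exp_neg_mul_int_sq (mul_pos pi_pos hc)).tsum_ofReal_ne_top
  refine ne_top_of_le_ne_top (b := expect (fun z : ℤ =>
    ENNReal.ofReal (exp (-(π * c) * (z : ℝ) ^ 2))) fun _ : Fin n → ℤ => 1) ?_ ?_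
  · rw [h]; exact ENNReal.pow_ne_top hfin
  · refine ENNReal.tsum_le_tsum fun v => ?_
    rw [mul_one, ← ENNReal.ofReal_prod_of_nonneg fun _ _ => exp_nonneg _, ← exp_sum,
      ← Finset.mul_sum]
    refine ENNReal.ofReal_le_ofReal (exp_le_exp.2 ?_)
    linear_combination π * hq v

end QuadraticGaussian

section EllipsoidalForm

variable {n : ℕ}

/-- The quadratic form in the exponent of `rho S`, on integer vectors. -/
noncomputable def ellipsoidForm (S : Matrix (Fin n) (Fin n) ℝ) (v : Fin n → ℤ) : ℝ :=
  intCast' v ⬝ᵥ ((Sᵀ * S)⁻¹ *ᵥ intCast' v)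

theorem ellipsoidForm_parallelogram (S : Matrix (Fin n) (Fin n) ℝ) (x y : Fin n → ℤ) :
    ellipsoidForm S (x + y) + ellipsoidForm S (x - y)
      = 2 * ellipsoidForm S x + 2 * ellipsoidForm S y := by
  have hadd : intCast' (x + y) = intCast' x + intCast' y := by
    funext i; simp [intCast']
  have hsub : intCast' (x - y) = intCast' x - intCast' y := by
    funext i; simp [intCast']
  simp only [ellipsoidForm, hadd, hsub, Matrix.mulVec_add, Matrix.mulVec_sub, dotProduct_add,
    dotProduct_sub, add_dotProduct, sub_dotProduct]
  ring

theorem enorm'_sq {k : ℕ} (x : Fin k → ℝ) : enorm' x ^ 2 = x ⬝ᵥ x := by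
  rw [enorm', Real.sq_sqrt (Finset.sum_nonneg fun i _ => sq_nonneg _), dotProduct]
  exact Finset.sum_congr rfl fun i _ => sq _

theorem enorm'_nonneg {k : ℕ} (x : Fin k → ℝ) : 0 ≤ enorm' x := Real.sqrt_nonneg _

theorem dotProduct_sq_le {k : ℕ} (x y : Fin k → ℝ) : (x ⬝ᵥ y) ^ 2 ≤ (x ⬝ᵥ x) * (y ⬝ᵥ y) := by
  simpa only [dotProduct, sq] using Finset.sum_mul_sq_le_sq_mul_sq Finset.univ x y

theorem dotProduct_self_nonneg' {k : ℕ} (x : Fin k → ℝ) : 0 ≤ x ⬝ᵥ x := by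
  rw [← enorm'_sq]; positivity

theorem dotProduct_gram_mulVec (S : Matrix (Fin n) (Fin n) ℝ) (x y : Fin n → ℝ) :
    x ⬝ᵥ ((Sᵀ * S) *ᵥ y) = (S *ᵥ x) ⬝ᵥ (S *ᵥ y) := by
  rw [← Matrix.mulVec_mulVec, Matrix.dotProduct_mulVec, Matrix.vecMul_transpose]

theorem isUnit_det_gram {S : Matrix (Fin n) (Fin n) ℝ} (hS : IsUnit S.det) :
    IsUnit (Sᵀ * S).det := by
  rw [Matrix.det_mul, Matrix.det_transpose]
  exact hS.mul hS

theorem gram_mulVec_inv_mulVec {S : Matrix (Fin n) (Fin n) ℝ} (hS : IsUnit S.det)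
    (x : Fin n → ℝ) : (Sᵀ * S) *ᵥ ((Sᵀ * S)⁻¹ *ᵥ x) = x := by
  rw [Matrix.mulVec_mulVec, Matrix.mul_nonsing_inv _ (isUnit_det_gram hS), Matrix.one_mulVec]

theorem dotProduct_gram_inv_mulVec {S : Matrix (Fin n) (Fin n) ℝ} (hS : IsUnit S.det)
    (x : Fin n → ℝ) : x ⬝ᵥ ((Sᵀ * S)⁻¹ *ᵥ x)
      = (S *ᵥ ((Sᵀ * S)⁻¹ *ᵥ x)) ⬝ᵥ (S *ᵥ ((Sᵀ * S)⁻¹ *ᵥ x)) := by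
  rw [← dotProduct_gram_mulVec, gram_mulVec_inv_mulVec hS, dotProduct_comm]

theorem gram_inv_form_le {S : Matrix (Fin n) (Fin n) ℝ} (hS : IsUnit S.det) {σ : ℝ} (hσ0 : 0 ≤ σ)
    (hσ : ∀ x : Fin n → ℝ, σ * enorm' x ≤ enorm' (S *ᵥ x)) (x : Fin n → ℝ) :
    σ ^ 2 * (x ⬝ᵥ ((Sᵀ * S)⁻¹ *ᵥ x)) ≤ x ⬝ᵥ x := by
  have h1 := dotProduct_gram_inv_mulVec hS x
  set y := (Sᵀ * S)⁻¹ *ᵥ x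
  have h2 : σ ^ 2 * (y ⬝ᵥ y) ≤ x ⬝ᵥ y := by
    rw [h1, ← enorm'_sq, ← enorm'_sq, ← mul_pow]
    exact pow_le_pow_left₀ (mul_nonneg hσ0 (enorm'_nonneg _)) (hσ y) 2
  have h3 := dotProduct_sq_le x y
  have h4 : 0 ≤ x ⬝ᵥ y := by rw [h1]; exact dotProduct_self_nonneg' _
  rcases h4.eq_or_lt with h | h
  · rw [← h, mul_zero]; exact dotProduct_self_nonneg' _
  · refine le_of_mul_le_mul_right ?_ h
    nlinarith [mul_le_mul_of_nonneg_left h3 (sq_nonneg σ),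
      mul_le_mul_of_nonneg_left h2 (dotProduct_self_nonneg' x)]

theorem le_gram_inv_form {S : Matrix (Fin n) (Fin n) ℝ} (hS : IsUnit S.det) {σ : ℝ}
    (hσ : ∀ x : Fin n → ℝ, enorm' (S *ᵥ x) ≤ σ * enorm' x) (x : Fin n → ℝ) :
    x ⬝ᵥ x ≤ σ ^ 2 * (x ⬝ᵥ ((Sᵀ * S)⁻¹ *ᵥ x)) := by
  have h1 := dotProduct_gram_inv_mulVec hS x
  have h0 := gram_mulVec_inv_mulVec hS x
  set y := (Sᵀ * S)⁻¹ *ᵥ x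
  have h2 : x ⬝ᵥ x = (S *ᵥ x) ⬝ᵥ (S *ᵥ y) := by rw [← dotProduct_gram_mulVec, h0]
  have h3 := dotProduct_sq_le (S *ᵥ x) (S *ᵥ y)
  have h4 : (S *ᵥ x) ⬝ᵥ (S *ᵥ x) ≤ σ ^ 2 * (x ⬝ᵥ x) := by
    rw [← enorm'_sq, ← enorm'_sq, ← mul_pow]
    exact pow_le_pow_left₀ (enorm'_nonneg _) (hσ x) 2
  rw [← h2, ← h1] at h3
  have h5 : 0 ≤ x ⬝ᵥ y := by rw [h1]; exact dotProduct_self_nonneg' _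
  rcases (dotProduct_self_nonneg' x).eq_or_lt with h | h
  · rw [← h]; positivity
  · refine le_of_mul_le_mul_right ?_ h
    nlinarith [mul_le_mul_of_nonneg_right h4 h5]

theorem intCast'_dotProduct_self (v : Fin n → ℤ) :
    intCast' v ⬝ᵥ intCast' v = ∑ i, (v i : ℝ) ^ 2 := by
  simp [dotProduct, intCast', sq]

end EllipsoidalForm

section Parameters

open Real

theorem gaussian_tail_constant_le {n t : ℕ} (hn : 1 ≤ n) (ht : 100 ≤ t) :
    (t : ℝ) * (2 ^ n * exp (π * (n / 25) / 4) * exp (-(3 * π / 4 * (n * logb 2 t))))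
      ≤ (1 / 8) ^ n := by
  have ht0 : (100 : ℝ) ≤ t := by exact_mod_cast ht
  have hpi := pi_gt_three
  have hpi' := pi_lt_four
  have hlog : 0 ≤ log t := log_nonneg (by linarith)
  have hlog2 : 0 < log 2 := log_pos one_lt_two
  have h1 : exp (π * (n / 25) / 4) ≤ 2 ^ n := by
    have h2n : (2 : ℝ) ^ n = exp (n * log 2) := by rw [exp_nat_mul, exp_log zero_lt_two]
    rw [h2n]
    refine exp_le_exp.2 ?_
    have : (n : ℝ) * (π / 100) ≤ n * log 2 := by
      gcongr
      linarith [log_two_gt_d9]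
    linarith
  have h2 : exp (-(3 * π / 4 * (n * logb 2 t))) ≤ ((t : ℝ) ^ 3)⁻¹ ^ n := by
    have h3 : exp (n * (3 * log t)) = ((t : ℝ) ^ 3) ^ n := by
      rw [exp_nat_mul, show (3 : ℝ) * log t = (3 : ℕ) * log t by norm_num, exp_nat_mul,
        exp_log (by linarith)]
    rw [inv_pow, ← h3, ← exp_neg]
    refine exp_le_exp.2 (neg_le_neg ?_)
    have h4 : log t * log 2 ≤ π / 4 * log t := by nlinarith [log_two_lt_d9]
    have h5 : log t ≤ π / 4 * logb 2 t := by
      rw [logb, ← mul_div_assoc, le_div_iff₀ hlog2]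
      exact h4
    calc n * (3 * log t) ≤ n * (3 * (π / 4 * logb 2 t)) := by gcongr
      _ = _ := by ring
  have h6 : (t : ℝ) ≤ (t : ℝ) ^ n := le_self_pow₀ (by linarith) (by omega)
  calc _ ≤ (t : ℝ) ^ n * (2 ^ n * 2 ^ n * ((t : ℝ) ^ 3)⁻¹ ^ n) := by gcongr
    _ = (t * (2 * 2 * ((t : ℝ) ^ 3)⁻¹)) ^ n := by simp only [mul_pow]
    _ ≤ _ := by
      refine pow_le_pow_left₀ (by positivity) ?_ n
      have : (t : ℝ) * (2 * 2 * ((t : ℝ) ^ 3)⁻¹) = 4 / t ^ 2 := by field_simp; ring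
      rw [this, div_le_div_iff₀ (by positivity) (by norm_num)]
      nlinarith

theorem search_constant_le {n : ℕ} (hn : 100 ≤ n) {σ : ℝ} (hσ : 5 ≤ σ) :
    (2 : ℝ) ^ n * ((2 * ((⌊30 * n * logb 2 (σ * n)⌋₊ : ℝ) *
        ⌊σ * √(n * logb 2 (⌊30 * n * logb 2 (σ * n)⌋₊ : ℕ))⌋₊) + 1) ^ n *
        (2 * (⌊30 * n * logb 2 (σ * n)⌋₊ : ℝ) + 1) ^ n)
          * (4 / 5) ^ ⌊30 * n * logb 2 (σ * n)⌋₊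
      ≤ (1 / 4) ^ n := by
  have hn' : (100 : ℝ) ≤ n := by exact_mod_cast hn
  set s : ℝ := σ * n with hs
  have hs500 : 500 ≤ s := by nlinarith
  set ℓ := logb 2 s with hℓ
  have hℓ0 : 0 ≤ ℓ := logb_nonneg one_lt_two (by linarith)
  have hlogb : ∀ x : ℝ, 1 ≤ x → logb 2 x ≤ 2 * x := by
    intro x hx
    rw [logb, div_le_iff₀ (log_pos one_lt_two)]
    nlinarith [log_le_sub_one_of_pos (by linarith : 0 < x), log_two_gt_d9]
  set k := ⌊30 * n * ℓ⌋₊ with hk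
  have hkle : (k : ℝ) ≤ 30 * n * ℓ := Nat.floor_le (by positivity)
  have hklt : 30 * n * ℓ < k + 1 := Nat.lt_floor_add_one _
  have hks : (k : ℝ) ≤ 12 * s ^ 2 := by
    have h1 : ℓ ≤ 2 * s := hlogb s (by linarith)
    have h2 : 5 * (n : ℝ) ≤ s := by nlinarith
    nlinarith
  set b := ⌊σ * √(n * logb 2 k)⌋₊ with hb
  have hbs : (b : ℝ) ≤ 5 * s ^ 2 := by
    refine (Nat.floor_le (by positivity)).trans ?_
    have h1 : logb 2 k ≤ 2 * (12 * s ^ 2) := by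
      rcases Nat.eq_zero_or_pos k with h | h
      · rw [h]; simp; positivity
      · have h1k : (1 : ℝ) ≤ k := by exact_mod_cast h
        linarith [hlogb k h1k]
    have h2 : √(n * logb 2 k) ≤ √((n * (5 * s)) ^ 2) := by
      refine sqrt_le_sqrt ?_
      calc n * logb 2 k ≤ n * (2 * (12 * s ^ 2)) := by gcongr
        _ ≤ n * (n * (25 * s ^ 2)) := by gcongr ?_ * ?_; nlinarith [sq_nonneg s]
        _ = _ := by ring
    rw [sqrt_sq (by positivity)] at h2
    calc σ * √(n * logb 2 k) ≤ σ * (n * (5 * s)) := by gcongr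
      _ = 5 * s ^ 2 := by rw [hs]; ring
  have hpow : ((4 : ℝ) / 5) ^ k ≤ 2 ^ n * (s ^ 9)⁻¹ ^ n := by
    have h1 : ((4 : ℝ) / 5) ^ k ≤ (4 / 5 : ℝ) ^ (30 * n * ℓ - 1) := by
      rw [← rpow_natCast]
      exact rpow_le_rpow_of_exponent_ge (by norm_num) (by norm_num) (by linarith)
    have h2 : ((4 : ℝ) / 5) ^ (30 * n * ℓ) ≤ (s ^ 9)⁻¹ ^ n := by
      have h3 : (2 : ℝ) ^ ℓ = s := rpow_logb two_pos (by norm_num) (by linarith)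
      calc ((4 : ℝ) / 5) ^ (30 * n * ℓ) = (((4 : ℝ) / 5) ^ (10 : ℝ)) ^ (ℓ * (3 * n : ℕ)) := by
            rw [← rpow_mul (by norm_num)]; congr 1; push_cast; ring
        _ ≤ ((2 : ℝ) ^ (-3 : ℝ)) ^ (ℓ * (3 * n : ℕ)) := by
            refine rpow_le_rpow (by positivity) ?_ (by positivity)
            rw [rpow_neg zero_le_two, show (10 : ℝ) = (10 : ℕ) by norm_num,
              show (3 : ℝ) = (3 : ℕ) by norm_num, rpow_natCast, rpow_natCast]
            norm_num
        _ = (((2 : ℝ) ^ ℓ) ^ 9)⁻¹ ^ n := by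
            rw [inv_pow, ← pow_mul, ← rpow_natCast ((2 : ℝ) ^ ℓ), ← rpow_mul zero_le_two,
              ← rpow_mul zero_le_two, ← rpow_neg zero_le_two]
            congr 1
            push_cast
            ring
        _ = _ := by rw [h3]
    rw [rpow_sub (by norm_num), rpow_one] at h1
    refine h1.trans ?_
    have h4 : (2 : ℝ) ≤ 2 ^ n := le_self_pow₀ one_le_two (by omega)
    have h5 : 0 ≤ (s ^ 9)⁻¹ ^ n := by positivity
    rw [div_le_iff₀ (by norm_num)]
    nlinarith
  calc _ ≤ (2 : ℝ) ^ n * ((2 * (12 * s ^ 2 * (5 * s ^ 2)) + 1) ^ n * (2 * (12 * s ^ 2) + 1) ^ n)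
        * (2 ^ n * (s ^ 9)⁻¹ ^ n) := by gcongr
    _ = (2 * ((2 * (12 * s ^ 2 * (5 * s ^ 2)) + 1) * (2 * (12 * s ^ 2) + 1))
        * (2 * (s ^ 9)⁻¹)) ^ n := by simp only [mul_pow]
    _ ≤ _ := by
      refine pow_le_pow_left₀ (by positivity) ?_ n
      have h1 : 2 * (12 * s ^ 2 * (5 * s ^ 2)) + 1 ≤ 121 * s ^ 4 := by
        have : (1 : ℝ) ≤ s ^ 4 := one_le_pow₀ (by linarith)
        linarith
      have h2 : 2 * (12 * s ^ 2) + 1 ≤ 25 * s ^ 2 := by nlinarith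
      have h3 : (125000000 : ℝ) ≤ s ^ 3 := by
        calc (125000000 : ℝ) = 500 ^ 3 := by norm_num
          _ ≤ _ := by gcongr
      calc _ ≤ 2 * (121 * s ^ 4 * (25 * s ^ 2)) * (2 * (s ^ 9)⁻¹) := by gcongr
        _ = 12100 / s ^ 3 := by field_simp; norm_num
        _ ≤ 1 / 4 := by rw [div_le_div_iff₀ (by positivity) (by norm_num)]; linarith

theorem five_le_of_smoothing_bound {n : ℕ} (hn : 100 ≤ n) {ε σ : ℝ} (hε : 0 < ε)
    (hσ : 9 * √(log (2 * n * (1 + 1 / ε)) / π) ≤ σ) : 5 ≤ σ := by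
  have hn' : (100 : ℝ) ≤ n := by exact_mod_cast hn
  have h1 : exp 1 ≤ 2 * n * (1 + 1 / ε) := by
    have : 0 < 1 / ε := by positivity
    nlinarith [exp_one_lt_d9]
  have h2 : 1 ≤ log (2 * n * (1 + 1 / ε)) := by
    rw [le_log_iff_exp_le ((exp_pos 1).trans_le h1)]
    exact h1
  have h3 : (5 / 9 : ℝ) ≤ √(log (2 * n * (1 + 1 / ε)) / π) := by
    refine le_sqrt_of_sq_le ?_
    rw [le_div_iff₀ pi_pos]
    nlinarith [pi_lt_d2]
  linarith

theorem enorm'_single {n : ℕ} (i : Fin n) : enorm' (Pi.single i 1) = 1 := by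
  simp [enorm', Pi.single_apply]

end Parameters

section Assembly

variable {n : ℕ}

/-- There are pairwise orthogonal dual vectors of squared norm at most `k`. -/
def HasShortDual (k : ℕ) (t : ℕ) (X : Fin t → Fin n → ℤ) : Prop :=
  ∃ U : Fin t → Fin n → ℤ, (∀ j j', j ≠ j' → ∑ s, U s j * U s j' = 0) ∧
    (∀ j a, ∑ s, U s j * X s a = if j = a then 1 else 0) ∧ ∀ j, ∑ s, U s j ^ 2 ≤ k

theorem HasDual.hasShortDual {t : ℕ} {X : Fin t → Fin n → ℤ} (h : HasDual X) :
    HasShortDual t t X := by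
  obtain ⟨U, hU⟩ := h
  refine ⟨U, hU.orthogonal, fun j a => hU.dual j a j.2, fun j => ?_⟩
  calc ∑ s, U s j ^ 2 ≤ ∑ _s : Fin t, (1 : ℤ) :=
        Finset.sum_le_sum fun s _ => (sq_le_one_iff_abs_le_one _).2 (hU.abs_le s j)
    _ = t := by simp

theorem HasShortDual.cons {k t : ℕ} {X : Fin t → Fin n → ℤ} (h : HasShortDual k t X)
    (v : Fin n → ℤ) : HasShortDual k (t + 1) (Fin.cons v X) := by
  obtain ⟨U, h1, h2, h3⟩ := h
  refine ⟨Fin.cons 0 U, fun j j' hj => ?_, fun j a => ?_, fun j => ?_⟩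
  · simpa [Fin.sum_univ_succ] using h1 j j' hj
  · simpa [Fin.sum_univ_succ] using h2 j a
  · simpa [Fin.sum_univ_succ] using h3 j

theorem HasShortDual.hasQuality {k m : ℕ} {X : Fin m → Fin n → ℤ} (h : HasShortDual k m X)
    {q1 q2 : ℝ} (hq1 : ∀ j, Real.sqrt (∑ i, (X j i : ℝ) ^ 2) ≤ q1) (hq2 : Real.sqrt k ≤ q2) :
    HasQuality (Matrix.of fun i j => X j i) q1 q2 := by
  obtain ⟨U, h1, h2, h3⟩ := h
  refine ⟨hq1, fun i j => U j i, h1, fun i i' => ?_, fun i => le_trans ?_ hq2⟩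
  · simpa using h2 i i'
  · refine Real.sqrt_le_sqrt ?_
    exact_mod_cast h3 i

theorem expect_add_expect_not {α : Type*} {w : α → ℝ≥0∞} (hw : ∑' v, w v = 1) {t : ℕ}
    (p : (Fin t → α) → Prop) :
    expect w (fun X => if p X then 1 else 0) + expect w (fun X => if p X then 0 else 1) = 1 := by
  have h := expect_one w t
  rw [hw, one_pow] at h
  rw [← expect_add]
  refine (congrArg (expect w) (funext fun X => ?_)).trans h
  split_ifs
  · exact add_zero _
  · exact zero_add _

end Assembly

section DiscreteGaussian

open Real

variable {n : ℕ} {S : Matrix (Fin n) (Fin n) ℝ} {σ1 σn : ℝ}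

/-- Probability of `v` under the discrete Gaussian with parameter `S`. -/
noncomputable def gaussianProb (S : Matrix (Fin n) (Fin n) ℝ) (v : Fin n → ℤ) : ℝ≥0∞ :=
  gaussianWeight (ellipsoidForm S) v / ∑' y, gaussianWeight (ellipsoidForm S) y

theorem ellipsoidForm_le (hS : IsUnit S.det) (hσ0 : 0 < σn)
    (hσn : ∀ x : Fin n → ℝ, σn * enorm' x ≤ enorm' (S *ᵥ x)) (v : Fin n → ℤ) :
    ellipsoidForm S v ≤ (∑ i, (v i : ℝ) ^ 2) / σn ^ 2 := by
  rw [le_div_iff₀ (by positivity), mul_comm, ← intCast'_dotProduct_self]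
  exact gram_inv_form_le hS hσ0.le hσn _

theorem le_ellipsoidForm (hS : IsUnit S.det)
    (hσ1 : ∀ x : Fin n → ℝ, enorm' (S *ᵥ x) ≤ σ1 * enorm' x) (v : Fin n → ℤ) :
    ∑ i, (v i : ℝ) ^ 2 ≤ σ1 ^ 2 * ellipsoidForm S v := by
  rw [← intCast'_dotProduct_self]
  exact le_gram_inv_form hS hσ1 _

theorem tsum_ellipsoid_ne_zero (S : Matrix (Fin n) (Fin n) ℝ) :
    ∑' v, gaussianWeight (ellipsoidForm S) v ≠ 0 := by
  intro h
  have := ENNReal.tsum_eq_zero.1 h 0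
  rw [gaussianWeight, ENNReal.ofReal_eq_zero] at this
  exact absurd (exp_pos _) (not_lt.2 this)

theorem tsum_ellipsoid_ne_top (hS : IsUnit S.det) (hσ0 : 0 < σ1)
    (hσ1 : ∀ x : Fin n → ℝ, enorm' (S *ᵥ x) ≤ σ1 * enorm' x) :
    ∑' v, gaussianWeight (ellipsoidForm S) v ≠ ⊤ := by
  refine tsum_gaussianWeight_ne_top (c := (σ1 ^ 2)⁻¹) (by positivity) fun v => ?_
  rw [inv_mul_le_iff₀ (by positivity)]
  exact le_ellipsoidForm hS hσ1 v

theorem tsum_gaussianProb (hS : IsUnit S.det) (hσ0 : 0 < σ1)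
    (hσ1 : ∀ x : Fin n → ℝ, enorm' (S *ᵥ x) ≤ σ1 * enorm' x) : ∑' v, gaussianProb S v = 1 := by
  simp only [gaussianProb, div_eq_mul_inv]
  rw [ENNReal.tsum_mul_right]
  exact ENNReal.mul_inv_cancel (tsum_ellipsoid_ne_zero S) (tsum_ellipsoid_ne_top hS hσ0 hσ1)

theorem tsum_gaussianProb_mul (S : Matrix (Fin n) (Fin n) ℝ) (g : (Fin n → ℤ) → ℝ≥0∞) :
    ∑' v, gaussianProb S v * g v = (∑' v, gaussianWeight (ellipsoidForm S) v * g v)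
      / ∑' v, gaussianWeight (ellipsoidForm S) v := by
  simp only [gaussianProb, div_eq_mul_inv, mul_right_comm]
  rw [ENNReal.tsum_mul_right]

theorem gaussianProb_shift (hS : IsUnit S.det) (hσ5 : 5 ≤ σn)
    (hσn : ∀ x : Fin n → ℝ, σn * enorm' x ≤ enorm' (S *ᵥ x)) (i : Fin n)
    (G : Set (Fin n → ℤ)) (hG : ∀ g ∈ G, -g ∈ G) :
    4 / 5 * ∑' v, gaussianProb S v * (if v ∈ G then 1 else 0)
      ≤ ∑' v, gaussianProb S v * (if v - Pi.single i 1 ∈ G then 1 else 0) := by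
  rw [tsum_gaussianProb_mul, tsum_gaussianProb_mul, ← mul_div_assoc]
  refine ENNReal.div_le_div_right (le_trans ?_
    (gaussianWeight_mul_tsum_le (ellipsoidForm_parallelogram S) (Pi.single i 1) G hG)) _
  gcongr
  have hform : ellipsoidForm S (Pi.single i 1) ≤ 1 / 25 := by
    refine (ellipsoidForm_le hS (by linarith) hσn _).trans ?_
    have : ∑ j, ((Pi.single i 1 : Fin n → ℤ) j : ℝ) ^ 2 = 1 := by simp [Pi.single_apply]
    rw [this]
    gcongr
    nlinarith
  have h45 : (4 / 5 : ℝ≥0∞) = ENNReal.ofReal (4 / 5) := by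
    rw [ENNReal.ofReal_div_of_pos (by norm_num), ENNReal.ofReal_ofNat, ENNReal.ofReal_ofNat]
  rw [h45, gaussianWeight]
  refine ENNReal.ofReal_le_ofReal ?_
  have h1 := add_one_le_exp (-π * ellipsoidForm S (Pi.single i 1))
  nlinarith [pi_lt_four, pi_pos]

/-- Total mass of the long vectors among `t` samples. -/
theorem gaussianProb_tail (hn : 1 ≤ n) (hS : IsUnit S.det) (hσ0 : 0 < σ1)
    (hσ1 : ∀ x : Fin n → ℝ, enorm' (S *ᵥ x) ≤ σ1 * enorm' x) (hσ5 : 5 ≤ σn)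
    (hσn : ∀ x : Fin n → ℝ, σn * enorm' x ≤ enorm' (S *ᵥ x)) {t : ℕ} (ht : 100 ≤ t)
    (p : (Fin n → ℤ) → Prop)
    (hp : ∀ v, p v → σ1 * √(n * logb 2 t) < √(∑ i, (v i : ℝ) ^ 2)) :
    t * ∑' v, gaussianProb S v * (if p v then 1 else 0) ≤ ENNReal.ofReal ((1 / 8) ^ n) := by
  have ht1 : (1 : ℝ) ≤ t := by exact_mod_cast (by omega : 1 ≤ t)
  have hform : ∀ v, p v → n * logb 2 t < ellipsoidForm S v := by
    intro v hv
    have h1 := hp v hv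
    have hlog : 0 ≤ logb 2 t := logb_nonneg one_lt_two ht1
    rw [lt_sqrt (by positivity), mul_pow, sq_sqrt (by positivity)] at h1
    exact lt_of_mul_lt_mul_left (h1.trans_le (le_ellipsoidForm hS hσ1 v)) (by positivity)
  have hQ : ∀ d : Fin n → Bool, ellipsoidForm S (fun i => if d i then 1 else 0) ≤ n / 25 := by
    intro d
    refine (ellipsoidForm_le hS (by linarith) hσn _).trans ?_
    have h1 : ∑ i, (((if d i then 1 else 0 : ℤ)) : ℝ) ^ 2 ≤ n := by
      calc _ ≤ ∑ _i : Fin n, (1 : ℝ) := Finset.sum_le_sum fun i _ => by split_ifs <;> simp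
        _ = n := by simp
    gcongr
    nlinarith
  have htail := tsum_gaussianWeight_tail_le (ellipsoidForm_parallelogram S) hQ (n * logb 2 t)
  have hle : ∑' v, gaussianProb S v * (if p v then 1 else 0)
      ≤ ENNReal.ofReal (2 ^ n * exp (π * (n / 25) / 4) * exp (-(3 * π / 4 * (n * logb 2 t)))) := by
    rw [tsum_gaussianProb_mul]
    refine ENNReal.div_le_of_le_mul (le_trans (ENNReal.tsum_le_tsum fun v => ?_) htail)
    gcongr
    by_cases hv : p v
    · simp [hv, hform v hv]
    · simp [hv]
  calc _ ≤ (t : ℝ≥0∞) * ENNReal.ofReal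
        (2 ^ n * exp (π * (n / 25) / 4) * exp (-(3 * π / 4 * (n * logb 2 t)))) := by gcongr
    _ = ENNReal.ofReal (t * (2 ^ n * exp (π * (n / 25) / 4)
        * exp (-(3 * π / 4 * (n * logb 2 t))))) := by
      rw [ENNReal.ofReal_mul (Nat.cast_nonneg t), ENNReal.ofReal_natCast]
    _ ≤ _ := ENNReal.ofReal_le_ofReal (gaussian_tail_constant_le hn ht)

theorem abs_le_sqrt_sum_sq (v : Fin n → ℤ) (a : Fin n) :
    ((|v a| : ℤ) : ℝ) ≤ √(∑ i, (v i : ℝ) ^ 2) := by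
  rw [Int.cast_abs]
  refine abs_le_sqrt ?_
  exact Finset.single_le_sum (f := fun i => (v i : ℝ) ^ 2) (fun i _ => sq_nonneg _)
    (Finset.mem_univ a)

/-- Failure probability of the quality bound under independent discrete Gaussian columns. -/
theorem expect_not_hasQuality_le (hn : 100 ≤ n) (hS : IsUnit S.det)
    (hσ1 : ∀ x : Fin n → ℝ, enorm' (S *ᵥ x) ≤ σ1 * enorm' x) (hσ5 : 5 ≤ σn)
    (hσn : ∀ x : Fin n → ℝ, σn * enorm' x ≤ enorm' (S *ᵥ x)) {m : ℕ}
    (hm : 30 * n * logb 2 (σ1 * n) < m) :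
    expect (gaussianProb S) (fun X : Fin m → Fin n → ℤ =>
        if HasQuality (Matrix.of fun i j => X j i) (σ1 * √(n * logb 2 m))
          (2 * √(30 * n * logb 2 (σ1 * n))) then 0 else 1)
      ≤ ENNReal.ofReal ((1 / 2) ^ n) := by
  have hσ15 : 5 ≤ σ1 := by
    let i : Fin n := ⟨0, by omega⟩
    have h := (hσn (Pi.single i 1)).trans (hσ1 (Pi.single i 1))
    rw [enorm'_single] at h
    linarith
  have hn' : (100 : ℝ) ≤ n := by exact_mod_cast hn
  have hσ0 : 0 < σ1 := by linarith
  have hw := tsum_gaussianProb hS hσ0 hσ1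
  have hL : 1 ≤ logb 2 (σ1 * n) := by
    rw [le_logb_iff_rpow_le one_lt_two (by positivity), rpow_one]
    nlinarith
  set k := ⌊30 * n * logb 2 (σ1 * n)⌋₊ with hk
  have hkle : (k : ℝ) ≤ 30 * n * logb 2 (σ1 * n) := Nat.floor_le (by positivity)
  have hkm : k ≤ m := by exact_mod_cast (hkle.trans hm.le)
  have hk100 : 100 ≤ k := Nat.le_floor (by push_cast; nlinarith)
  set B := ⌊σ1 * √(n * logb 2 k)⌋₊ with hB
  have hlong : expect (gaussianProb S) (fun X : Fin m → Fin n → ℤ =>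
      if ∃ s, σ1 * √(n * logb 2 m) < √(∑ i, (X s i : ℝ) ^ 2) then 1 else 0)
      ≤ ENNReal.ofReal ((1 / 8) ^ n) :=
    (expect_exists_le hw (fun v => σ1 * √(n * logb 2 m) < √(∑ i, (v i : ℝ) ^ 2)) m).trans
      (gaussianProb_tail (by omega) hS hσ0 hσ1 hσ5 hσn (hk100.trans hkm) _ fun _ h => h)
  have hshort : expect (gaussianProb S) (fun X : Fin m → Fin n → ℤ =>
      if ¬ HasShortDual k m X then 1 else 0)
      ≤ ENNReal.ofReal ((1 / 8) ^ n) + ENNReal.ofReal ((1 / 4) ^ n) := by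
    have hanti : expect (gaussianProb S) (fun X : Fin m → Fin n → ℤ =>
          if ¬ HasShortDual k m X then 1 else 0)
        ≤ expect (gaussianProb S) (fun X : Fin k → Fin n → ℤ =>
          if ¬ HasShortDual k k X then 1 else 0) := by
      convert expect_antitone_of_cons hw (fun t X => ¬ HasShortDual k t X)
        (fun t v X h h' => h (h'.cons v)) hkm
    have hmono : expect (gaussianProb S) (fun X : Fin k → Fin n → ℤ =>
          if ¬ HasShortDual k k X then 1 else 0)
        ≤ expect (gaussianProb S) (fun X : Fin k → Fin n → ℤ => if ¬ HasDual X then 1 else 0) := by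
      refine expect_mono fun X => ?_
      by_cases h : HasDual X
      · simp [h, h.hasShortDual]
      · simp only [h, not_false_eq_true, if_true]
        split_ifs <;> simp
    refine (hanti.trans hmono).trans ((expect_not_hasDual_le hw
      (gaussianProb_shift hS hσ5 hσn) k B).trans (add_le_add ?_ ?_))
    · have htail := gaussianProb_tail (by omega) hS hσ0 hσ1 hσ5 hσn hk100
        (fun v => ∃ a, (B : ℤ) < |v a|) (by
          rintro v ⟨a, ha⟩
          refine lt_of_lt_of_le ?_ (abs_le_sqrt_sum_sq v a)
          refine (Nat.lt_floor_add_one _).trans_le ?_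
          exact_mod_cast ha)
      refine le_of_eq_of_le ?_ htail
      congr!
    · refine le_trans (le_of_eq ?_) (ENNReal.ofReal_le_ofReal (search_constant_le hn hσ15))
      rw [← hk, ← hB, ENNReal.ofReal_mul (by positivity), ENNReal.ofReal_pow (by norm_num),
        ENNReal.ofReal_div_of_pos (by norm_num), ENNReal.ofReal_ofNat, ENNReal.ofReal_ofNat]
      congr 1
      have hcast : (2 : ℝ) ^ n * ((2 * ((k : ℝ) * B) + 1) ^ n * (2 * (k : ℝ) + 1) ^ n)
          = (2 ^ n * ((2 * (k * B) + 1) ^ n * (2 * k + 1) ^ n) : ℕ) := by push_cast; rfl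
      rw [hcast, ENNReal.ofReal_natCast]
      push_cast
      rfl
  calc _ ≤ expect (gaussianProb S) (fun X : Fin m → Fin n → ℤ =>
        (if ∃ s, σ1 * √(n * logb 2 m) < √(∑ i, (X s i : ℝ) ^ 2) then 1 else 0)
          + if ¬ HasShortDual k m X then 1 else 0) := by
        refine expect_mono fun X => ?_
        by_cases h1 : ∃ s, σ1 * √(n * logb 2 m) < √(∑ i, (X s i : ℝ) ^ 2)
        · rw [if_pos h1]
          split_ifs <;> simp
        by_cases h2 : HasShortDual k m X
        · push Not at h1
          have hq2 : √(k : ℝ) ≤ 2 * √(30 * n * logb 2 (σ1 * n)) := by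
            linarith [sqrt_le_sqrt hkle, sqrt_nonneg (30 * n * logb 2 (σ1 * n))]
          rw [if_pos (h2.hasQuality h1 hq2)]
          exact zero_le
        · rw [if_pos h2]
          split_ifs <;> simp
    _ ≤ ENNReal.ofReal ((1 / 8) ^ n)
        + (ENNReal.ofReal ((1 / 8) ^ n) + ENNReal.ofReal ((1 / 4) ^ n)) := by
        rw [expect_add]
        exact add_le_add hlong hshort
    _ ≤ _ := by
        rw [← ENNReal.ofReal_add (by positivity) (by positivity),
          ← ENNReal.ofReal_add (by positivity) (by positivity)]
        refine ENNReal.ofReal_le_ofReal ?_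
        have h4 : ((1 : ℝ) / 4) ^ n = (1 / 2) ^ n * (1 / 2) ^ n := by
          rw [← mul_pow]; norm_num
        have h8 : ((1 : ℝ) / 8) ^ n = (1 / 2) ^ n * (1 / 4) ^ n := by
          rw [← mul_pow]; norm_num
        have h2 : ((1 : ℝ) / 2) ^ n ≤ 1 / 2 := pow_le_of_le_one (by norm_num) (by norm_num) (by omega)
        have h0 : 0 < ((1 : ℝ) / 2) ^ n := by positivity
        rw [h8, h4]
        nlinarith [mul_pos h0 h0]

theorem gaussianProb_toReal (hS : IsUnit S.det) (hσ0 : 0 < σ1)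
    (hσ1 : ∀ x : Fin n → ℝ, enorm' (S *ᵥ x) ≤ σ1 * enorm' x) (v : Fin n → ℤ) :
    (gaussianProb S v).toReal = rho S (intCast' v) / ∑' y : Fin n → ℤ, rho S (intCast' y) := by
  have h : ∀ v, (gaussianWeight (ellipsoidForm S) v).toReal = rho S (intCast' v) := fun v =>
    ENNReal.toReal_ofReal (exp_nonneg _)
  rw [gaussianProb, ENNReal.toReal_div, h,
    ENNReal.tsum_toReal_eq (ENNReal.ne_top_of_tsum_ne_top (tsum_ellipsoid_ne_top hS hσ0 hσ1))]
  simp only [h]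

end DiscreteGaussian

/-- Lemma 4.2. Let `n ≥ 100`, `ε ∈ (0, 1/1000)`, `S ∈ ℝ^{n×n}` invertible
with largest/least singular values `σ1`/`σn` (characterized by `σn‖x‖ ≤ ‖Sx‖ ≤ σ1‖x‖`), and
`σn ≥ 9·√(ln(2n(1+1/ε))/π)`.  Let `m > 30·n·log₂(σ1·n)` and draw the `m` columns of
`X ∈ ℤ^{n×m}` independently from `D_{ℤ^n, S}` (so the probability of a set of matrices is the
sum over it of the product of the column probabilities `ρ_S(x)/ρ_S(ℤ^n)`).  Then with
probability at least `1 − 2^{−n}`, `X` has quality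
`(σ1·√(n·log₂ m), 2·√(30·n·log₂(σ1·n)))`. -/
theorem statement5 {n : ℕ} (hn : 100 ≤ n) (ε : ℝ) (hε0 : 0 < ε) (hε : ε < 1 / 1000)
    (S : Matrix (Fin n) (Fin n) ℝ) (hS : IsUnit S.det)
    (σ1 σn : ℝ)
    (hσ1 : ∀ x : Fin n → ℝ, enorm' (S *ᵥ x) ≤ σ1 * enorm' x)
    (hσn : ∀ x : Fin n → ℝ, σn * enorm' x ≤ enorm' (S *ᵥ x))
    (hσnB : σn ≥ 9 * Real.sqrt (Real.log (2 * n * (1 + 1 / ε)) / Real.pi))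
    (m : ℕ) (hm : (m : ℝ) > 30 * n * Real.logb 2 (σ1 * n)) :
    (∑' X : Matrix (Fin n) (Fin m) ℤ,
        if HasQuality X (σ1 * Real.sqrt (n * Real.logb 2 m))
            (2 * Real.sqrt (30 * n * Real.logb 2 (σ1 * n))) then
          ∏ j : Fin m,
            (rho S (intCast' (fun i => X i j)) / ∑' y : Fin n → ℤ, rho S (intCast' y))
        else 0)
      ≥ 1 - (2 : ℝ) ^ (-(n : ℤ)) := by
  have hσ5 : 5 ≤ σn := five_le_of_smoothing_bound hn hε0 hσnB
  have hσ0 : 0 < σ1 := by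
    let i : Fin n := ⟨0, by omega⟩
    have h := (hσn (Pi.single i 1)).trans (hσ1 (Pi.single i 1))
    rw [enorm'_single] at h
    linarith
  have hbad := expect_not_hasQuality_le hn hS hσ1 hσ5 hσn hm
  have htotal := expect_add_expect_not (tsum_gaussianProb hS hσ0 hσ1)
    (fun X : Fin m → Fin n → ℤ => HasQuality (Matrix.of fun i j => X j i)
      (σ1 * Real.sqrt (n * Real.logb 2 m)) (2 * Real.sqrt (30 * n * Real.logb 2 (σ1 * n))))
  have hgood : (expect (gaussianProb S) (fun X : Fin m → Fin n → ℤ =>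
        if HasQuality (Matrix.of fun i j => X j i) (σ1 * Real.sqrt (n * Real.logb 2 m))
          (2 * Real.sqrt (30 * n * Real.logb 2 (σ1 * n))) then 1 else 0)).toReal
      = ∑' X : Matrix (Fin n) (Fin m) ℤ,
        if HasQuality X (σ1 * Real.sqrt (n * Real.logb 2 m))
            (2 * Real.sqrt (30 * n * Real.logb 2 (σ1 * n))) then
          ∏ j : Fin m,
            (rho S (intCast' (fun i => X i j)) / ∑' y : Fin n → ℤ, rho S (intCast' y))
        else 0 := by
    rw [expect, ENNReal.tsum_toReal_eq (ENNReal.ne_top_of_tsum_ne_top (ne_top_of_le_ne_top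
      ENNReal.one_ne_top (le_of_le_of_eq le_self_add htotal)))]
    let flip : Matrix (Fin n) (Fin m) ℤ ≃ (Fin m → Fin n → ℤ) :=
      ⟨fun X j i => X i j, fun Y i j => Y j i, fun _ => rfl, fun _ => rfl⟩
    rw [← flip.tsum_eq]
    refine tsum_congr fun X => ?_
    change ((∏ s, gaussianProb S (flip X s)) *
      if HasQuality X (σ1 * Real.sqrt (n * Real.logb 2 m))
        (2 * Real.sqrt (30 * n * Real.logb 2 (σ1 * n))) then 1 else 0).toReal = _
    rw [ENNReal.toReal_mul, ENNReal.toReal_prod]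
    simp only [gaussianProb_toReal hS hσ0 hσ1]
    split_ifs
    · rw [ENNReal.toReal_one, mul_one]
      rfl
    · rw [ENNReal.toReal_zero, mul_zero]
  rw [← hgood]
  set a := expect (gaussianProb S) (fun X : Fin m → Fin n → ℤ =>
    if HasQuality (Matrix.of fun i j => X j i) (σ1 * Real.sqrt (n * Real.logb 2 m))
      (2 * Real.sqrt (30 * n * Real.logb 2 (σ1 * n))) then 1 else 0)
  set b := expect (gaussianProb S) (fun X : Fin m → Fin n → ℤ =>
    if HasQuality (Matrix.of fun i j => X j i) (σ1 * Real.sqrt (n * Real.logb 2 m))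
      (2 * Real.sqrt (30 * n * Real.logb 2 (σ1 * n))) then 0 else 1)
  have ha : a ≠ ⊤ := fun h => by simp [h] at htotal
  have hb : b ≠ ⊤ := fun h => by simp [h] at htotal
  have hsum := congrArg ENNReal.toReal htotal
  rw [ENNReal.toReal_add ha hb, ENNReal.toReal_one] at hsum
  have hb' := ENNReal.toReal_le_of_le_ofReal (by positivity) hbad
  have hpow : (2 : ℝ) ^ (-(n : ℤ)) = (1 / 2) ^ n := by
    rw [zpow_neg, zpow_natCast, one_div, inv_pow]
  rw [hpow]
  linarith
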